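/- arXiv:1703.08086 — 2 statements merged into one kernel-verified Lean document; each statement's English description precedes it below -/
import Mathlib

section
/- Let q be a prime power, b, c ∈ F_q*, and k an integer with 1 ≤ k < q − 1; set m = gcd(k+1, q−1). Then the number of pairs (x, y) ∈ F_q × F_q satisfying c·x·y^m·(1 + x + x² + … + x^{k−1}) = b (note every solution automatically has x ≠ 0 and y ≠ 0) is at least q − (k−1)(m−1)·√q − k, where √q denotes the real square root of q. -/
theorem eq_of_weight_eq {m k A R i j u i' j' u' : ℕ} (hcop : k.Coprime m) (hm : 0 < m)
    (hR : R = m * (A + k) + 1) (hu : u < A) (hu' : u' < A) (hj : j < m) (hj' : j' < m)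
    (h : u + i * R + j * ((A + k) * k) = u' + i' * R + j' * ((A + k) * k)) : i = i' ∧ j = j' := by
  have h5 : (R : ℤ) = m * (A + k) + 1 := by exact_mod_cast hR
  have key : ((m * i + j * k : ℤ) - (m * i' + j' * k)) * R
      = (m * u' - j' * k) - (m * u - j * k) := by
    have h4 : (u + i * R + j * ((A + k) * k) : ℤ) = u' + i' * R + j' * ((A + k) * k) := by
      exact_mod_cast h
    linear_combination (m : ℤ) * h4 + (j * k - j' * k : ℤ) * h5
  have hRpos : (0 : ℤ) < R := by rw [h5]; positivity
  have habs : |((m * i + j * k : ℤ) - (m * i' + j' * k)) * R| < R := by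
    rw [key]
    have q1 : (m * u : ℤ) ≤ m * (A - 1) := by
      apply mul_le_mul_of_nonneg_left _ (by positivity); omega
    have q2 : (m * u' : ℤ) ≤ m * (A - 1) := by
      apply mul_le_mul_of_nonneg_left _ (by positivity); omega
    have q3 : (j * k : ℤ) ≤ m * k := by
      apply mul_le_mul_of_nonneg_right _ (by positivity); omega
    have q4 : (j' * k : ℤ) ≤ m * k := by
      apply mul_le_mul_of_nonneg_right _ (by positivity); omega
    have q6 : (0 : ℤ) ≤ m * u := by positivity
    have q7 : (0 : ℤ) ≤ m * u' := by positivity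
    have q8 : (0 : ℤ) ≤ j * k := by positivity
    have q9 : (0 : ℤ) ≤ j' * k := by positivity
    have q10 : (0 : ℤ) < m := by positivity
    rw [abs_lt]
    constructor <;> linarith
  rw [abs_mul, abs_of_pos hRpos] at habs
  have hz : |(m * i + j * k : ℤ) - (m * i' + j' * k)| < 1 := by nlinarith
  rw [Int.abs_lt_one_iff] at hz
  have hdvd : (m : ℤ) ∣ (j - j' : ℤ) := by
    have : (m : ℤ) ∣ (j - j' : ℤ) * k := ⟨i' - i, by linear_combination hz⟩
    refine IsCoprime.dvd_of_dvd_mul_right ?_ this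
    exact (Nat.isCoprime_iff_coprime.mpr hcop).symm
  have hjj : (j - j' : ℤ) = 0 := by
    apply Int.eq_zero_of_abs_lt_dvd hdvd
    rw [abs_lt]; omega
  have hj2 : j = j' := by omega
  subst hj2
  have : (m : ℤ) * (i - i') = 0 := by linear_combination hz
  rcases mul_eq_zero.mp this with h | h
  · omega
  · exact ⟨by omega, rfl⟩

set_option maxHeartbeats 1000000 in
open Polynomial in
theorem stepanov_bound {K : Type*} [Field K] [Fintype K] [DecidableEq K] (p : ℕ)
    [Fact p.Prime] [CharP K p] (s e k m : ℕ) (g : K[X]) (hg : g.Monic) (hgk : g.natDegree = k)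
    (hcop : k.Coprime m) (hm : 0 < m) (hR : p ^ s = m * e + 1)
    (hQ : Fintype.card K = (p ^ s) ^ 2) (he : 2 * k + 2 ≤ e) (a : K) (ha : a ≠ 0) :
    (Finset.univ.filter fun x : K => g.eval x ^ (e * (p ^ s + 1)) = a).card
      ≤ e * p ^ s + (3 * k + 3) * p ^ s := by
  classical
  set R := p ^ s with hRdef
  set H := g ^ e with hH
  have hHm : H.Monic := hg.pow e
  have hHd : H.natDegree = e * k := by rw [hH, hg.natDegree_pow, hgk]
  obtain ⟨A, rfl⟩ : ∃ A, e = A + k := ⟨e - k, by omega⟩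
  set e := A + k with hedef
  set I := e + (2 * k + 2) with hI
  let Φ : (Fin I × Fin m → (Fin A → K)) → K[X] := fun t =>
    ∑ ij : Fin I × Fin m, C (a ^ (ij.2 : ℕ)) * (ofFn A (t ij)) ^ R * X ^ (ij.1 : ℕ)
      * H ^ (m - 1 - (ij.2 : ℕ))
  have hΦsub : ∀ t t', Φ (t - t') = Φ t - Φ t' := by
    intro t t'
    simp only [Φ, ← Finset.sum_sub_distrib]
    refine Finset.sum_congr rfl fun ij _ => ?_
    rw [Pi.sub_apply, map_sub, hRdef, sub_pow_char_pow]
    ring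
  set D := (A - 1) * R + I + (m - 1) * (e * k) with hD
  have hA : 0 < A := by omega
  have hofdeg : ∀ v : Fin A → K, (ofFn A v).natDegree ≤ A - 1 := by
    intro v
    have := ofFn_natDegree_lt (R := K) (n := A) (by omega) v
    omega
  have hΦdeg : ∀ t, (Φ t).natDegree < D := by
    intro t
    have hI0 : 0 < I := by omega
    refine lt_of_le_of_lt (natDegree_sum_le_of_forall_le (n := D - 1) _ _ fun ij _ => ?_) (by omega)
    have h1 : (C (a ^ (ij.2 : ℕ)) * (ofFn A (t ij)) ^ R).natDegree ≤ (A - 1) * R := by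
      refine (natDegree_C_mul_le _ _).trans (natDegree_pow_le.trans ?_)
      rw [mul_comm]
      exact Nat.mul_le_mul_right _ (hofdeg _)
    have h2 : (X ^ (ij.1 : ℕ) : K[X]).natDegree ≤ I - 1 := by
      rw [natDegree_X_pow]; omega
    have h3 : (H ^ (m - 1 - (ij.2 : ℕ))).natDegree ≤ (m - 1) * (e * k) := by
      rw [hHm.natDegree_pow, hHd]
      exact Nat.mul_le_mul_right _ (by omega)
    have := natDegree_mul_le_of_le (natDegree_mul_le_of_le h1 h2) h3
    omega
  have hcard : Fintype.card (Fin D → K) < Fintype.card (Fin I × Fin m → (Fin A → K)) := by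
    simp only [Fintype.card_fun, Fintype.card_fin, Fintype.card_prod]
    rw [← pow_mul]
    refine Nat.pow_lt_pow_right Fintype.one_lt_card ?_
    rw [hD, hI, hR]
    obtain ⟨A', rfl⟩ : ∃ A', A = A' + (k + 2) := ⟨A - (k + 2), by omega⟩
    obtain ⟨m', rfl⟩ : ∃ m', m = m' + 1 := ⟨m - 1, by omega⟩
    simp only [hedef, Nat.add_sub_cancel]
    have : A' + (k + 2) - 1 = A' + k + 1 := by omega
    rw [this]
    nlinarith [Nat.zero_le (m' * A'), Nat.zero_le (m' * k), Nat.zero_le (A' * k),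
      Nat.zero_le (m' * A' * k), Nat.zero_le (m' * k * k), Nat.zero_le (k * k)]
  obtain ⟨t, t', hne, heq⟩ := Fintype.exists_ne_map_eq_of_card_lt
    (fun t : (Fin I × Fin m → (Fin A → K)) => fun n : Fin D => (Φ t).coeff n) hcard
  set d := t - t' with hd
  have hd0 : d ≠ 0 := sub_ne_zero.mpr hne
  have hΦ0 : Φ d = 0 := by
    rw [hd, hΦsub, sub_eq_zero]
    ext n
    by_cases hn : n < D
    · exact congrFun heq ⟨n, hn⟩
    · rw [coeff_eq_zero_of_natDegree_lt ((hΦdeg t).trans_le (by omega)),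
        coeff_eq_zero_of_natDegree_lt ((hΦdeg t').trans_le (by omega))]
  let f : Fin I × Fin m → K[X] := fun ij =>
    ofFn A (d ij) * X ^ ((ij.1 : ℕ) * R) * H ^ (ij.2 : ℕ)
  set w : K[X] := ∑ ij, f ij with hw
  have hfdeg : ∀ ij, f ij ≠ 0 → (f ij).natDegree =
      (ofFn A (d ij)).natDegree + ij.1 * R + ij.2 * (e * k) := by
    intro ij hij
    have h1 : ofFn A (d ij) ≠ 0 := by
      rintro h; exact hij (by simp [f, h])
    simp only [f]
    rw [natDegree_mul (mul_ne_zero h1 (by simp)) (hHm.pow _).ne_zero,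
      natDegree_mul h1 (by simp), natDegree_X_pow, hHm.natDegree_pow, hHd]
  have hw0 : w ≠ 0 := by
    have hdis := degree_sum_eq_of_disjoint f Finset.univ (by
      intro ij hij ij' hij' hne' hdeg
      apply hne'
      have h1 := hfdeg ij hij.2
      have h2 := hfdeg ij' hij'.2
      have h3 : (f ij).natDegree = (f ij').natDegree := natDegree_eq_of_degree_eq hdeg
      rw [h1, h2] at h3
      have b1 := hofdeg (d ij)
      have b2 := hofdeg (d ij')
      obtain ⟨⟨i, hi⟩, ⟨j, hj⟩⟩ := ij
      obtain ⟨⟨i', hi'⟩, ⟨j', hj'⟩⟩ := ij'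
      simp only at h3
      set u := (ofFn A (d (⟨i, hi⟩, ⟨j, hj⟩))).natDegree
      set u' := (ofFn A (d (⟨i', hi'⟩, ⟨j', hj'⟩))).natDegree
      obtain ⟨rfl, rfl⟩ := eq_of_weight_eq hcop hm (R := R) (A := A) (by rw [hR]) (by omega)
        (by omega) hj hj' (h3 : u + i * R + j * ((A + k) * k) = u' + i' * R + j' * ((A + k) * k))
      rfl)
    intro h0
    have hw' : ∑ ij, f ij = 0 := h0
    rw [hw', degree_zero] at hdis
    obtain ⟨ij, hij⟩ : ∃ ij, d ij ≠ 0 := by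
      by_contra! hcon
      exact hd0 (funext hcon)
    have hfij : f ij ≠ 0 := by
      refine mul_ne_zero (mul_ne_zero ?_ (by simp)) (hHm.pow _).ne_zero
      intro h
      apply hij
      funext u
      have := congrArg (fun q : K[X] => q.coeff u) h
      simpa [ofFn_coeff_eq_val_of_lt] using this
    have hle := Finset.le_sup (f := fun i => degree (f i)) (Finset.mem_univ ij)
    rw [← hdis] at hle
    exact hfij (degree_eq_bot.mp (le_bot_iff.mp hle))
  have hwdeg : w.natDegree ≤ e * R + (3 * k + 3) * R := by
    refine natDegree_sum_le_of_forall_le _ _ fun ij _ => ?_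
    by_cases hij : f ij = 0
    · simp [hij]
    rw [hfdeg ij hij]
    have h1 := hofdeg (d ij)
    have h2 : (ij.1 : ℕ) * R ≤ (e + (2 * k + 1)) * R := Nat.mul_le_mul_right _ (by omega)
    have h3 : (ij.2 : ℕ) * (e * k) ≤ k * R := by
      rw [hR]
      have : (ij.2 : ℕ) ≤ m := by omega
      nlinarith [Nat.mul_le_mul_right (e * k) this]
    have h4 : A ≤ R := by rw [hR]; nlinarith
    have h5 := h1.trans ((Nat.sub_le A 1).trans h4)
    linarith
  refine le_trans ?_ hwdeg
  refine card_le_degree_of_subset_roots (p := w) ?_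
  intro x hx
  simp only [Finset.filter_val, Multiset.mem_filter] at hx
  rw [mem_roots hw0, IsRoot.def]
  set h0 := H.eval x with hh0
  have hxa : h0 ^ (R + 1) = a := by
    rw [hh0, hH, eval_pow, ← pow_mul]; exact hx.2
  have hxQ : x ^ (R * R) = x := by
    rw [← sq, ← hQ]; exact FiniteField.pow_card x
  have h0ne : h0 ≠ 0 := by
    rintro h
    rw [h, zero_pow (by omega)] at hxa
    exact ha hxa.symm
  have hwR : (w.eval x) ^ R * h0 ^ (m - 1) = (Φ d).eval x := by
    rw [hw, eval_finsetSum, hRdef, sum_pow_char_pow, Finset.sum_mul, eval_finsetSum]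
    refine Finset.sum_congr rfl fun ij _ => ?_
    simp only [f, eval_mul, eval_pow, eval_X, eval_C, ← hRdef, ← hh0]
    have hj : m - 1 = ij.2 + (m - 1 - ij.2) := by omega
    rw [mul_pow, mul_pow, ← pow_mul x, mul_assoc (ij.1 : ℕ), mul_comm (ij.1 : ℕ), pow_mul x, hxQ,
      ← hxa]
    conv_lhs => rw [hj, pow_add]
    ring
  rw [hΦ0, eval_zero] at hwR
  rcases mul_eq_zero.mp hwR with h | h
  · exact pow_eq_zero_iff (by omega) |>.mp h
  · exact absurd h (pow_ne_zero _ h0ne)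

theorem exists_isPrimitiveRoot_card_sub_one (F : Type*) [Field F] [Fintype F] :
    ∃ ζ : F, IsPrimitiveRoot ζ (Fintype.card F - 1) := by
  classical
  obtain ⟨ζ, hζ⟩ := IsCyclic.exists_ofOrder_eq_natCard (α := Fˣ)
  refine ⟨ζ, ?_⟩
  rw [IsPrimitiveRoot.coe_units_iff, ← Fintype.card_units, ← Nat.card_eq_fintype_card, ← hζ]
  exact IsPrimitiveRoot.orderOf ζ

section PowerResidues

variable {F : Type*} [Field F] [Fintype F] {n d : ℕ}

theorem card_filter_pow_eq_pow [DecidableEq F] (h : Fintype.card F - 1 = n * d) {v : F}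
    (hv : v ≠ 0) : (Finset.univ.filter fun u : F => u ^ n = v ^ n).card = n := by
  obtain ⟨ζ, hζ⟩ := exists_isPrimitiveRoot_card_sub_one F
  have hpos : 0 < Fintype.card F - 1 := by have := Fintype.one_lt_card (α := F); omega
  have hn : 0 < n := Nat.pos_of_mul_pos_right (h ▸ hpos)
  have hω : IsPrimitiveRoot (ζ ^ d) n := hζ.pow hpos (by rw [h, mul_comm])
  have hnd := hω.nthRoots_nodup (a := v ^ n) (pow_ne_zero _ hv)
  have hc := hω.card_nthRoots (v ^ n)
  rw [if_pos ⟨v, rfl⟩] at hc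
  refine Eq.trans ?_ hc
  rw [← Multiset.toFinset_card_of_nodup hnd]
  congr 1
  ext u
  simp [Polynomial.mem_nthRoots hn]

theorem exists_eq_pow_of_pow_eq_one (h : Fintype.card F - 1 = n * d) {w : F} (hw : w ^ n = 1) :
    ∃ z : F, z ≠ 0 ∧ w = z ^ d := by
  obtain ⟨ζ, hζ⟩ := exists_isPrimitiveRoot_card_sub_one F
  have hpos : 0 < Fintype.card F - 1 := by have := Fintype.one_lt_card (α := F); omega
  have hn : 0 < n := Nat.pos_of_mul_pos_right (h ▸ hpos)
  have : NeZero n := ⟨hn.ne'⟩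
  have hω : IsPrimitiveRoot (ζ ^ d) n := hζ.pow hpos (by rw [h, mul_comm])
  obtain ⟨i, -, hi⟩ := hω.eq_pow_of_pow_eq_one hw
  refine ⟨ζ ^ i, pow_ne_zero _ (hζ.ne_zero hpos.ne'), ?_⟩
  rw [← hi, ← pow_mul, ← pow_mul, mul_comm]

theorem MulChar.apply_eq_of_pow_eq_pow (h : Fintype.card F - 1 = n * d) {χ : MulChar F ℂ}
    (hχ : χ ^ d = 1) {u v : F} (hv : v ≠ 0) (huv : u ^ n = v ^ n) : χ u = χ v := by
  obtain ⟨z, hz, hzd⟩ := exists_eq_pow_of_pow_eq_one (w := u / v) h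
    (by rw [div_pow, huv, div_self (pow_ne_zero _ hv)])
  have hχd : χ (z ^ d) = 1 := by
    rcases Nat.eq_zero_or_pos d with rfl | hd
    · simp
    · rw [map_pow, ← MulChar.pow_apply' χ hd.ne', hχ, MulChar.one_apply hz.isUnit]
  have : u = z ^ d * v := by rw [← hzd, div_mul_cancel₀ _ hv]
  rw [this, map_mul, hχd, one_mul]

end PowerResidues

open Polynomial in
theorem norm_charSum_extension_le {F K : Type*} [Field F] [Fintype F] [Field K] [Fintype K]
    [Algebra F K] {k m t : ℕ} (g : F[X]) (hg : g.Monic) (hgk : g.natDegree = k)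
    (hcop : k.Coprime m) (hm : m ∣ Fintype.card F - 1)
    (hK : Fintype.card K = (Fintype.card F ^ t) ^ 2)
    (ht : m * (2 * k + 2) < Fintype.card F ^ t) (χ : MulChar F ℂ) (hχ : χ ≠ 1) (hχm : χ ^ m = 1) :
    ‖∑ x : K, χ (Algebra.norm F (aeval x g))‖
      ≤ (2 * m * (3 * k + 3) + k) * (Fintype.card F : ℝ) ^ t := by
  classical
  obtain ⟨p, hp⟩ := CharP.exists F
  have : CharP K p := charP_of_injective_algebraMap' F p
  obtain ⟨c, hpp, hc⟩ := FiniteField.card F p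
  have : Fact p.Prime := ⟨hpp⟩
  obtain ⟨e₀, he₀⟩ := hm
  have hq1 := Fintype.one_lt_card (α := F)
  set q := Fintype.card F with hq
  have hmpos : 0 < m := Nat.pos_of_ne_zero (by rintro rfl; omega)
  have he₀pos : 0 < e₀ := Nat.pos_of_ne_zero (by rintro rfl; omega)
  have hRp : p ^ ((c : ℕ) * t) = q ^ t := by rw [pow_mul, hc]
  have hdvd1 : q - 1 ∣ q ^ t - 1 := by simpa using Nat.sub_dvd_pow_sub_pow q 1 t
  obtain ⟨e, he⟩ : ∃ e, q ^ t = m * e + 1 := by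
    obtain ⟨f, hf⟩ := (Dvd.intro e₀ he₀.symm).trans hdvd1
    exact ⟨f, by have : 0 < q ^ t := by positivity
                 omega⟩
  set R := q ^ t with hR
  have he2 : 2 * k + 2 ≤ e := by
    have : m * (2 * k + 2) ≤ m * e := by omega
    exact Nat.le_of_mul_le_mul_left this hmpos
  -- the exponent of the power residue symbol
  have hexp : (Nat.card K - 1) / (Nat.card F - 1) * e₀ = e * (R + 1) := by
    rw [Nat.card_eq_fintype_card, Nat.card_eq_fintype_card, hK, ← hq]
    have hd : q - 1 ∣ R ^ 2 - 1 := by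
      rw [hR, ← pow_mul]; simpa using Nat.sub_dvd_pow_sub_pow q 1 (t * 2)
    obtain ⟨j, hj⟩ := hd
    rw [hj, Nat.mul_div_cancel_left _ (by omega)]
    have h1 : R ^ 2 - 1 = m * e * (R + 1) := by
      have : R ^ 2 - 1 = (R - 1) * (R + 1) := by
        have := Nat.sq_sub_sq R 1
        rw [one_pow] at this
        rw [this, mul_comm]
      rw [this]; congr 1; omega
    have h2 : m * (j * e₀) = m * (e * (R + 1)) := by
      rw [← mul_assoc m e, ← h1, hj, he₀]; ring
    exact Nat.eq_of_mul_eq_mul_left hmpos h2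
  have hnorm : ∀ y : K, ∀ u : F, Algebra.norm F y ^ e₀ = u ^ e₀ ↔
      y ^ (e * (R + 1)) = algebraMap F K (u ^ e₀) := by
    intro y u
    rw [← (algebraMap F K).injective.eq_iff, map_pow, FiniteField.algebraMap_norm_eq_pow, ← pow_mul,
      hexp]
  let N : K → F := fun x => Algebra.norm F (aeval x g)
  let T : F → ℕ := fun u => (Finset.univ.filter fun x : K => N x ^ e₀ = u ^ e₀).card
  have hTle : ∀ u ≠ 0, T u ≤ e * R + (3 * k + 3) * R := by
    intro u hu
    have := stepanov_bound p (c * t) e k m (g.map (algebraMap F K)) (hg.map _)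
      (by rw [natDegree_map, hgk]) hcop hmpos (by rw [hRp, he]) (by rw [hRp, hK]) he2
      (algebraMap F K (u ^ e₀)) (by simpa using fun h => absurd h hu)
    rw [hRp] at this
    convert! this using 4 with x
    simp only [N]
    rw [hnorm, eval_map_algebraMap]
  set U : Finset F := Finset.univ.erase 0 with hU
  have hUcard : U.card = q - 1 := by simp [hU, hq]
  have hzero : ∀ x, N x = 0 ↔ aeval x g = 0 := fun x => Algebra.norm_eq_zero_iff
  have hZ : (Finset.univ.filter fun x : K => N x = 0).card ≤ k := by
    rw [← hgk, ← natDegree_map (algebraMap F K)]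
    refine card_le_degree_of_subset_roots fun x hx => ?_
    rw [mem_roots (hg.map _).ne_zero, IsRoot.def, eval_map_algebraMap]
    simpa [hzero] using hx
  have hcnt : ∀ v : F, v ≠ 0 → (U.filter fun u => v ^ e₀ = u ^ e₀).card = e₀ := by
    intro v hv
    refine Eq.trans ?_ (card_filter_pow_eq_pow (n := e₀) (d := m) (by rw [← hq, he₀, mul_comm]) hv)
    congr 1
    ext u
    simp only [hU, Finset.mem_filter, Finset.mem_erase, Finset.mem_univ, and_true, true_and]
    refine ⟨fun h => h.2.symm, fun h => ⟨?_, h.symm⟩⟩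
    rintro rfl
    rw [zero_pow he₀pos.ne'] at h
    exact pow_ne_zero _ hv h.symm
  have hcnt0 : (U.filter fun u : F => (0 : F) ^ e₀ = u ^ e₀) = ∅ := by
    refine Finset.filter_eq_empty_iff.mpr fun u hu h => ?_
    rw [zero_pow he₀pos.ne'] at h
    exact pow_ne_zero _ (Finset.ne_of_mem_erase hu) h.symm
  have hTsum : (∑ u ∈ U, (T u : ℝ)) ≥ e₀ * ((R : ℝ) ^ 2 - k) := by
    have h1 : ∑ u ∈ U, T u = ∑ x : K, (U.filter fun u => N x ^ e₀ = u ^ e₀).card := by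
      simp only [T, Finset.card_filter]
      rw [Finset.sum_comm]
    have h2 : ∑ x : K, (U.filter fun u => N x ^ e₀ = u ^ e₀).card
        = ∑ x : K, if N x ≠ 0 then e₀ else 0 := by
      refine Finset.sum_congr rfl fun x _ => ?_
      split_ifs with h
      · exact hcnt _ h
      · push Not at h
        rw [h, hcnt0, Finset.card_empty]
    rw [← Finset.sum_filter, Finset.sum_const, smul_eq_mul] at h2
    have h3 := Finset.card_filter_add_card_filter_not (s := (Finset.univ : Finset K))
      (fun x => N x = 0)
    simp only [← ne_eq] at h3
    rw [Finset.card_univ, hK] at h3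
    rw [← Nat.cast_sum, h1, h2, ge_iff_le]
    push_cast
    rw [mul_comm]
    refine mul_le_mul_of_nonneg_right ?_ (by positivity)
    have h4 : ((R ^ 2 : ℕ) : ℝ) ≤ k + (Finset.univ.filter fun x : K => N x ≠ 0).card := by
      exact_mod_cast (by omega : R ^ 2 ≤ k + (Finset.univ.filter fun x : K => N x ≠ 0).card)
    push_cast at h4
    linarith
  have hχsum : ∑ u ∈ U, χ u = 0 := by
    have := MulChar.sum_eq_zero_of_ne_one hχ
    rw [← Finset.add_sum_erase _ _ (Finset.mem_univ (0 : F)), MulChar.map_zero, zero_add] at this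
    exact this
  have hkey : (e₀ : ℂ) * ∑ x : K, χ (N x) = ∑ u ∈ U, χ u * ((T u : ℂ) - (R : ℂ) ^ 2 / m) := by
    simp only [mul_sub, Finset.sum_sub_distrib, ← Finset.sum_mul, hχsum, zero_mul, sub_zero]
    simp only [T, Finset.card_filter, Nat.cast_sum, Finset.mul_sum]
    rw [Finset.sum_comm]
    refine Finset.sum_congr rfl fun x _ => ?_
    simp only [Nat.cast_ite, Nat.cast_one, Nat.cast_zero, mul_ite, mul_one, mul_zero]
    rw [← Finset.sum_filter]
    by_cases h : N x = 0
    · rw [h, hcnt0, Finset.sum_empty, MulChar.map_zero, mul_zero]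
    · rw [Finset.sum_congr rfl (g := fun _ => χ (N x)), Finset.sum_const, hcnt _ h, nsmul_eq_mul]
      intro u hu
      rw [Finset.mem_filter] at hu
      exact MulChar.apply_eq_of_pow_eq_pow (by rw [← hq, he₀, mul_comm]) hχm
        h hu.2.symm
  have hmR : (0 : ℝ) < m := by exact_mod_cast hmpos
  have hRR : (R : ℝ) = m * e + 1 := by exact_mod_cast he
  have hD : ∀ u ∈ U, ‖χ u * ((T u : ℂ) - (R : ℂ) ^ 2 / m)‖
      ≤ 2 * ((3 * k + 3) * R) - ((T u : ℝ) - (R : ℝ) ^ 2 / m) := by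
    intro u hu
    have hu0 := Finset.ne_of_mem_erase hu
    have h1 : ‖χ u‖ ≤ 1 := by
      refine (Complex.norm_eq_one_of_pow_eq_one (n := m) ?_ hmpos.ne').le
      rw [← MulChar.pow_apply' χ hmpos.ne', hχm, MulChar.one_apply hu0.isUnit]
    rw [norm_mul]
    have h2 : ((T u : ℂ) - (R : ℂ) ^ 2 / m) = (((T u : ℝ) - (R : ℝ) ^ 2 / m : ℝ) : ℂ) := by
      push_cast; rfl
    rw [h2, Complex.norm_real]
    refine (mul_le_of_le_one_left (norm_nonneg _) h1).trans ?_
    have h3 : (T u : ℝ) ≤ e * R + (3 * k + 3) * R := by exact_mod_cast hTle u hu0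
    have h4 : (e : ℝ) * R ≤ R ^ 2 / m := by
      rw [le_div_iff₀ hmR, sq]
      have : (e : ℝ) * m ≤ R := by rw [hRR]; linarith
      nlinarith [(Nat.cast_nonneg R : (0 : ℝ) ≤ R)]
    have h5 : (0 : ℝ) ≤ (3 * k + 3) * R := by positivity
    rw [Real.norm_eq_abs, abs_le]
    constructor <;> linarith
  have hfin : (e₀ : ℝ) * ‖∑ x : K, χ (N x)‖ ≤ e₀ * ((2 * m * (3 * k + 3) + k) * (R : ℝ)) := by
    calc (e₀ : ℝ) * ‖∑ x : K, χ (N x)‖ = ‖(e₀ : ℂ) * ∑ x : K, χ (N x)‖ := by simp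
      _ ≤ ∑ u ∈ U, (2 * ((3 * k + 3) * R) - ((T u : ℝ) - (R : ℝ) ^ 2 / m)) := by
        rw [hkey]; exact norm_sum_le_of_le _ hD
      _ = (U.card : ℝ) * (2 * ((3 * k + 3) * R) + (R : ℝ) ^ 2 / m) - ∑ u ∈ U, (T u : ℝ) := by
        simp only [Finset.sum_sub_distrib, Finset.sum_const, nsmul_eq_mul]; ring
      _ ≤ e₀ * ((2 * m * (3 * k + 3) + k) * (R : ℝ)) := by
        have hUm : (U.card : ℝ) = m * e₀ := by rw [hUcard, he₀]; push_cast; ring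
        rw [hUm]
        have h6 : (m * e₀ : ℝ) * ((R : ℝ) ^ 2 / m) = e₀ * (R : ℝ) ^ 2 := by field_simp
        have h7 : (e₀ : ℝ) * k ≤ e₀ * k * R := by
          refine le_mul_of_one_le_right (by positivity) ?_
          rw [hRR]; nlinarith [(Nat.cast_nonneg e : (0 : ℝ) ≤ e)]
        nlinarith
  have := le_of_mul_le_mul_left hfin (by exact_mod_cast he₀pos)
  simpa [N, hR] using this

section MonicSums

open Polynomial

variable (F : Type*) [Field F] [Finite F]

theorem finite_setOf_monic_natDegree_eq (n : ℕ) :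
    {f : F[X] | f.Monic ∧ f.natDegree = n}.Finite := by
  have : Finite (degreeLT F (n + 1)) := Module.finite_of_finite F
  refine (Set.toFinite (degreeLT F (n + 1) : Set F[X])).subset fun f hf => ?_
  rw [SetLike.mem_coe, mem_degreeLT, degree_eq_natDegree hf.1.ne_zero, hf.2]
  exact_mod_cast n.lt_succ_self

/-- The monic polynomials of degree `n`. -/
noncomputable def monicsOfDegree (n : ℕ) : Finset F[X] :=
  (finite_setOf_monic_natDegree_eq F n).toFinset

open Classical in
/-- The monic irreducible polynomials of degree `d`. -/
noncomputable def primesOfDegree (d : ℕ) : Finset F[X] :=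
  (monicsOfDegree F d).filter Irreducible

variable {F}

@[simp]
theorem mem_monicsOfDegree {n : ℕ} {f : F[X]} :
    f ∈ monicsOfDegree F n ↔ f.Monic ∧ f.natDegree = n := by
  simp [monicsOfDegree]

@[simp]
theorem mem_primesOfDegree {n : ℕ} {f : F[X]} :
    f ∈ primesOfDegree F n ↔ (f.Monic ∧ f.natDegree = n) ∧ Irreducible f := by
  simp [primesOfDegree]

/-- The sum of `ψ` over the monic polynomials of degree `n`. -/
noncomputable def monicSum (ψ : F[X] → ℂ) (n : ℕ) : ℂ := ∑ f ∈ monicsOfDegree F n, ψ f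

/-- The sum of `ψ` over the prime powers of degree `r`, weighted by the von Mangoldt function. -/
noncomputable def mangoldtSum (ψ : F[X] → ℂ) (r : ℕ) : ℂ :=
  ∑ d ∈ r.divisors, ∑ P ∈ primesOfDegree F d, (d : ℂ) * ψ P ^ (r / d)

open Classical in
theorem Polynomial.Monic.natDegree_eq_sum_primes {n : ℕ} {f : F[X]} (hf : f.Monic)
    (hn : f.natDegree = n) : n = ∑ d ∈ Finset.Icc 1 n, ∑ P ∈ primesOfDegree F d,
      d * ((Finset.Icc 1 n).filter fun j => P ^ j ∣ f).card := by
  set s := UniqueFactorizationMonoid.normalizedFactors f with hs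
  have hprod : s.prod = f := by
    rw [hs, UniqueFactorizationMonoid.prod_normalizedFactors_eq hf.ne_zero, hf.normalize_eq_self]
  have hmon : ∀ P ∈ s, P.Monic := fun P hP => by
    rw [← UniqueFactorizationMonoid.normalize_normalized_factor P hP]
    exact monic_normalize (UniqueFactorizationMonoid.irreducible_of_normalized_factor P hP).ne_zero
  have hirr : ∀ P ∈ s, Irreducible P :=
    UniqueFactorizationMonoid.irreducible_of_normalized_factor
  have hcount : ∀ d, ∀ P ∈ primesOfDegree F d,
      ((Finset.Icc 1 n).filter fun j => P ^ j ∣ f).card = s.count P := by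
    intro d P hP
    rw [mem_primesOfDegree] at hP
    have hiff : ∀ j, P ^ j ∣ f ↔ j ≤ s.count P := by
      intro j
      rw [pow_dvd_iff_le_emultiplicity,
        UniqueFactorizationMonoid.le_emultiplicity_iff_replicate_le_normalizedFactors hP.2
          hf.ne_zero, hP.1.1.normalize_eq_self, Multiset.le_count_iff_replicate_le]
    have hle : s.count P ≤ n := by
      have h1 := natDegree_le_of_dvd ((hiff _).2 le_rfl) hf.ne_zero
      rw [hP.1.1.natDegree_pow, hn] at h1
      exact (Nat.le_mul_of_pos_right _ hP.2.natDegree_pos).trans h1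
    have : (Finset.Icc 1 n).filter (fun j => P ^ j ∣ f) = Finset.Icc 1 (s.count P) := by
      ext j
      simp only [hiff, Finset.mem_filter, Finset.mem_Icc]
      omega
    rw [this, Nat.card_Icc, Nat.add_sub_cancel]
  have hsum : n = ∑ P ∈ s.toFinset, s.count P * P.natDegree := by
    rw [← hn, ← hprod, natDegree_multiset_prod_of_monic _ hmon, Finset.sum_multiset_map_count]
    simp
  rw [Finset.sum_congr rfl fun d _ => Finset.sum_congr rfl fun P hP => by rw [hcount d P hP]]
  refine hsum.trans ?_
  have hmaps : ∀ P ∈ s.toFinset, P.natDegree ∈ Finset.Icc 1 n := by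
    intro P hP
    rw [Multiset.mem_toFinset] at hP
    rw [Finset.mem_Icc, ← hn]
    exact ⟨(hirr P hP).natDegree_pos, natDegree_le_of_dvd
      (UniqueFactorizationMonoid.dvd_of_mem_normalizedFactors hP) hf.ne_zero⟩
  rw [← Finset.sum_fiberwise_of_maps_to hmaps]
  refine Finset.sum_congr rfl fun d _ => ?_
  refine Finset.sum_subset_zero_on_sdiff ?_ ?_ ?_
  · intro P hP
    rw [Finset.mem_filter, Multiset.mem_toFinset] at hP
    rw [mem_primesOfDegree]
    exact ⟨⟨hmon P hP.1, hP.2⟩, hirr P hP.1⟩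
  · intro P hP
    rw [Finset.mem_sdiff, Finset.mem_filter, Multiset.mem_toFinset, mem_primesOfDegree] at hP
    rw [Multiset.count_eq_zero_of_notMem fun h => hP.2 ⟨h, hP.1.1.2⟩, mul_zero]
  · intro P hP
    rw [Finset.mem_filter] at hP
    rw [hP.2, mul_comm]

theorem sum_monics_filter_dvd (ψ : F[X] → ℂ)
    (hmul : ∀ f g : F[X], f.Monic → g.Monic → ψ (f * g) = ψ f * ψ g) {n e : ℕ} (he : e ≤ n)
    {Q : F[X]} (hQ : Q.Monic) (hQe : Q.natDegree = e) [DecidablePred fun f : F[X] => Q ∣ f] :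
    ∑ f ∈ monicsOfDegree F n with Q ∣ f, ψ f = ψ Q * monicSum ψ (n - e) := by
  rw [monicSum, Finset.mul_sum]
  symm
  refine Finset.sum_bij (fun f _ => Q * f) ?_ ?_ ?_ ?_
  · intro f hf
    rw [mem_monicsOfDegree] at hf
    rw [Finset.mem_filter, mem_monicsOfDegree]
    exact ⟨⟨hQ.mul hf.1, by rw [hQ.natDegree_mul hf.1, hf.2, hQe]; omega⟩, dvd_mul_right _ _⟩
  · intro f _ f' _ h
    exact mul_left_cancel₀ hQ.ne_zero h
  · intro f hf
    rw [Finset.mem_filter, mem_monicsOfDegree] at hf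
    obtain ⟨⟨h1, h2⟩, f', rfl⟩ := hf
    have h3 : f'.Monic := hQ.of_mul_monic_left h1
    refine ⟨f', ?_, rfl⟩
    rw [mem_monicsOfDegree]
    rw [hQ.natDegree_mul h3, hQe] at h2
    exact ⟨h3, by omega⟩
  · intro f hf
    rw [mem_monicsOfDegree] at hf
    exact (hmul _ _ hQ hf.1).symm

theorem natCast_mul_monicSum (ψ : F[X] → ℂ) (h1 : ψ 1 = 1)
    (hmul : ∀ f g : F[X], f.Monic → g.Monic → ψ (f * g) = ψ f * ψ g) (n : ℕ) :
    (n : ℂ) * monicSum ψ n = ∑ r ∈ Finset.Icc 1 n, mangoldtSum ψ r * monicSum ψ (n - r) := by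
  classical
  have hpow : ∀ P : F[X], P.Monic → ∀ j, ψ (P ^ j) = ψ P ^ j := by
    intro P hP j
    induction j with
    | zero => simpa using h1
    | succ j ih => rw [pow_succ, hmul _ _ (hP.pow j) hP, ih, pow_succ]
  have hL : (n : ℂ) * monicSum ψ n = ∑ d ∈ Finset.Icc 1 n, ∑ P ∈ primesOfDegree F d,
      ∑ j ∈ Finset.Icc 1 n, if d * j ≤ n then (d : ℂ) * (ψ P ^ j * monicSum ψ (n - d * j))
        else 0 := by
    calc (n : ℂ) * monicSum ψ n = ∑ f ∈ monicsOfDegree F n, ∑ d ∈ Finset.Icc 1 n,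
          ∑ P ∈ primesOfDegree F d, ∑ j ∈ Finset.Icc 1 n, if P ^ j ∣ f then (d : ℂ) * ψ f else 0 := by
          rw [monicSum, Finset.mul_sum]
          refine Finset.sum_congr rfl fun f hf => ?_
          rw [mem_monicsOfDegree] at hf
          have := congrArg (fun t : ℕ => (t : ℂ) * ψ f) (hf.1.natDegree_eq_sum_primes hf.2)
          refine this.trans ?_
          push_cast
          rw [Finset.sum_mul]
          refine Finset.sum_congr rfl fun d _ => ?_
          rw [Finset.sum_mul]
          refine Finset.sum_congr rfl fun P _ => ?_
          rw [← Finset.sum_filter, Finset.sum_const, nsmul_eq_mul]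
          ring
      _ = _ := by
          rw [Finset.sum_comm]
          refine Finset.sum_congr rfl fun d hd => ?_
          rw [Finset.sum_comm]
          refine Finset.sum_congr rfl fun P hP => ?_
          rw [Finset.sum_comm]
          refine Finset.sum_congr rfl fun j hj => ?_
          rw [mem_primesOfDegree] at hP
          have hdeg : (P ^ j).natDegree = d * j := by rw [hP.1.1.natDegree_pow, hP.1.2, mul_comm]
          rw [← Finset.sum_filter, ← Finset.mul_sum]
          split_ifs with h
          · rw [sum_monics_filter_dvd ψ hmul h (hP.1.1.pow j) hdeg, hpow P hP.1.1]
          · rw [Finset.filter_eq_empty_iff.mpr, Finset.sum_empty, mul_zero]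
            intro f hf hdvd
            rw [mem_monicsOfDegree] at hf
            have := natDegree_le_of_dvd hdvd hf.1.ne_zero
            omega
  rw [hL]
  have hR : ∀ r ∈ Finset.Icc 1 n, mangoldtSum ψ r * monicSum ψ (n - r)
      = ∑ d ∈ Finset.Icc 1 n, ∑ j ∈ Finset.Icc 1 n, if d * j = r then
        ∑ P ∈ primesOfDegree F d, (d : ℂ) * (ψ P ^ j * monicSum ψ (n - d * j)) else 0 := by
    intro r hr
    rw [Finset.mem_Icc] at hr
    have hdiv : r.divisors = (Finset.Icc 1 n).filter fun d => d ∣ r := by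
      ext d
      rw [Nat.mem_divisors, Finset.mem_filter, Finset.mem_Icc]
      refine ⟨fun h => ⟨⟨Nat.pos_of_dvd_of_pos h.1 hr.1, (Nat.le_of_dvd hr.1 h.1).trans hr.2⟩, h.1⟩,
        fun h => ⟨h.2, by omega⟩⟩
    rw [mangoldtSum, Finset.sum_mul, hdiv, Finset.sum_filter]
    refine Finset.sum_congr rfl fun d hd => ?_
    rw [Finset.mem_Icc] at hd
    split_ifs with h
    · obtain ⟨e, rfl⟩ := h
      have he : 1 ≤ e := Nat.pos_of_mul_pos_left hr.1
      rw [Nat.mul_div_cancel_left _ hd.1, Finset.sum_eq_single e, if_pos rfl, Finset.sum_mul]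
      · simp only [mul_assoc]
      · intro j _ hj
        rw [if_neg fun h => hj (Nat.eq_of_mul_eq_mul_left hd.1 h)]
      · intro h
        exact absurd (Finset.mem_Icc.mpr ⟨he, (Nat.le_mul_of_pos_left e hd.1).trans hr.2⟩) h
    · rw [Finset.sum_eq_zero]
      intro j _
      rw [if_neg]
      rintro rfl
      exact h (dvd_mul_right _ _)
  rw [Finset.sum_congr rfl hR, Finset.sum_comm]
  refine Finset.sum_congr rfl fun d hd => ?_
  rw [Finset.sum_comm]
  conv_rhs => rw [Finset.sum_comm]
  refine Finset.sum_congr rfl fun j hj => ?_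
  rw [Finset.mem_Icc] at hd hj
  have : 0 < d * j := Nat.mul_pos hd.1 hj.1
  simp [Finset.sum_ite_eq, this, Nat.succ_le_iff]

end MonicSums

section ResultantCharacter

open Polynomial

theorem Polynomial.Monic.resultant_eq_of_natDegree_le {R : Type*} [CommRing R] {g f : R[X]}
    (hg : g.Monic) {n : ℕ} (hn : f.natDegree ≤ n) :
    resultant g f g.natDegree n = resultant g f := by
  obtain ⟨j, rfl⟩ := Nat.exists_eq_add_of_le hn
  rw [resultant_add_right_deg _ _ _ _ _ le_rfl, hg.coeff_natDegree, one_pow, one_mul]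

theorem Polynomial.Monic.resultant_mul_add_mul {R : Type*} [CommRing R] {g : R[X]} (hg : g.Monic)
    (u f s : R[X]) : resultant g (u * f + g * s) = resultant g u * resultant g f := by
  set N := (u * f + g * s).natDegree + (u.natDegree + f.natDegree) + (s.natDegree + g.natDegree)
    with hN
  rw [← hg.resultant_eq_of_natDegree_le (n := N) (by omega),
    resultant_add_mul_right _ _ _ _ _ (by omega) le_rfl,
    hg.resultant_eq_of_natDegree_le (natDegree_mul_le.trans (by omega)),
    ← resultant_mul_right _ _ _ _ le_rfl]
  exact (hg.resultant_eq_of_natDegree_le natDegree_mul_le).symm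

variable {F : Type*} [Field F] [Finite F]

theorem monicSum_resultant_eq_zero (χ : MulChar F ℂ) {g u : F[X]} (hg : g.Monic)
    (hu0 : resultant g u ≠ 0) (hu1 : χ (resultant g u) ≠ 1) {n : ℕ} (hn : g.natDegree ≤ n) :
    monicSum (fun f => χ (resultant f g)) n = 0 := by
  classical
  have hcop : IsCoprime g u := by
    by_contra h
    exact hu0 (resultant_eq_zero_iff.mpr ⟨Or.inl hg.ne_zero, h⟩)
  by_cases hg1 : g = 1
  · subst hg1
    exact absurd (by simp) hu1
  have hτdeg : ∀ f, f.Monic → f.natDegree = n → (((u - 1) * f) %ₘ g).degree < f.degree := by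
    intro f hf hfn
    refine (degree_modByMonic_lt _ hg).trans_le ?_
    rw [degree_eq_natDegree hg.ne_zero, degree_eq_natDegree hf.ne_zero, hfn]
    exact_mod_cast hn
  let τ : F[X] → F[X] := fun f => f + ((u - 1) * f) %ₘ g
  have hτ : ∀ f, τ f = u * f + g * (-(((u - 1) * f) /ₘ g)) := by
    intro f
    have := modByMonic_add_div ((u - 1) * f) g
    simp only [τ]
    linear_combination this
  have himg : (monicsOfDegree F n).image τ = monicsOfDegree F n := by
    refine Finset.eq_of_subset_of_card_le ?_ (Finset.card_image_of_injOn ?_).ge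
    · intro f' hf'
      obtain ⟨f, hf, rfl⟩ := Finset.mem_image.mp hf'
      rw [mem_monicsOfDegree] at hf ⊢
      have := hτdeg f hf.1 hf.2
      exact ⟨hf.1.add_of_left this, by rw [natDegree_add_eq_left_of_degree_lt this, hf.2]⟩
    · intro f _ f' _ h
      have h1 : f - f' = -(((u - 1) * (f - f')) %ₘ g) := by
        simp only [τ] at h
        rw [mul_sub, sub_modByMonic]
        linear_combination h
      have h2 : g ∣ f - f' := by
        refine hcop.dvd_of_dvd_mul_left ?_
        have h3 := hτ f
        have h4 := hτ f'
        rw [h, h4] at h3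
        exact ⟨-(((u - 1) * f') /ₘ g) + (((u - 1) * f) /ₘ g), by linear_combination -h3⟩
      have h5 : (f - f').degree < g.degree := by
        rw [h1, degree_neg]
        exact degree_modByMonic_lt _ hg
      exact sub_eq_zero.mp (eq_zero_of_dvd_of_degree_lt h2 h5)
  have hinj : Set.InjOn τ (monicsOfDegree F n) := by
    rw [← Finset.card_image_iff, himg]
  have hval : ∀ f ∈ monicsOfDegree F n, χ (resultant (τ f) g)
      = χ (resultant g u) * χ (resultant f g) := by
    intro f hf
    rw [mem_monicsOfDegree] at hf
    have hd : (τ f).natDegree = f.natDegree :=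
      natDegree_add_eq_left_of_degree_lt (hτdeg f hf.1 hf.2)
    rw [resultant_comm, resultant_comm f, hd, ← hd, hτ, hg.resultant_mul_add_mul, ← map_mul]
    rw [← hτ, hd]
    ring_nf
  have hsum : monicSum (fun f => χ (resultant f g)) n
      = χ (resultant g u) * monicSum (fun f => χ (resultant f g)) n := by
    unfold monicSum
    rw [Finset.mul_sum, ← Finset.sum_congr rfl hval, ← Finset.sum_image (f := fun f => χ (resultant f g)) hinj, himg]
  have : (χ (resultant g u) - 1) * monicSum (fun f => χ (resultant f g)) n = 0 := by
    linear_combination -hsum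
  exact (mul_eq_zero.mp this).resolve_left (sub_ne_zero.mpr hu1)

omit [Finite F] in
theorem apply_resultant_mul (χ : MulChar F ℂ) (g : F[X]) {f f' : F[X]} (hf : f.Monic)
    (hf' : f'.Monic) : χ (resultant (f * f') g) = χ (resultant f g) * χ (resultant f' g) := by
  rw [hf.natDegree_mul hf', resultant_mul_left _ _ _ _ le_rfl, map_mul]

theorem monicSum_zero (ψ : F[X] → ℂ) : monicSum ψ 0 = ψ 1 := by
  have : monicsOfDegree F 0 = {1} := by
    ext f
    rw [mem_monicsOfDegree, Finset.mem_singleton]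
    exact ⟨fun h => eq_one_of_monic_natDegree_zero h.1 h.2, by rintro rfl; simp⟩
  rw [monicSum, this, Finset.sum_singleton]

end ResultantCharacter

section ExtensionSums

open Polynomial IntermediateField

theorem norm_aeval_gen_eq_resultant {F L : Type*} [Field F] [Field L] [Algebra F L]
    [FiniteDimensional F L] [Algebra.IsSeparable F L] (pb : PowerBasis F L) (g : F[X]) :
    Algebra.norm F (aeval pb.gen g) = resultant (minpoly F pb.gen) g := by
  classical
  let E := AlgebraicClosure F
  have hsplit : ((minpoly F pb.gen).map (algebraMap F E)).Splits := IsAlgClosed.splits _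
  have hmon := minpoly.monic pb.isIntegral_gen
  have hdeg : ((minpoly F pb.gen).map (algebraMap F E)).natDegree = (minpoly F pb.gen).natDegree :=
    natDegree_map _
  apply (algebraMap F E).injective
  rw [← resultant_map_map, Algebra.norm_eq_prod_embeddings, ← hdeg,
    resultant_eq_prod_eval _ _ _ natDegree_map_le hsplit, (hmon.map _).leadingCoeff, one_pow,
    one_mul, @Fintype.prod_equiv (L →ₐ[F] E) _ _ _ _ _ pb.liftEquiv'
      (fun σ => σ (aeval pb.gen g)) (fun x => (g.map (algebraMap F E)).eval x) ?_]
  · rw [Finset.prod_mem_multiset, Finset.prod_eq_multiset_prod, Multiset.toFinset_val,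
      Multiset.dedup_eq_self.mpr]
    · exact nodup_roots (Separable.map (Algebra.IsSeparable.isSeparable F pb.gen))
    · exact fun _ => rfl
  · intro σ
    rw [PowerBasis.liftEquiv'_apply_coe, eval_map_algebraMap, aeval_algHom_apply]

theorem norm_aeval_eq_resultant_pow {F K : Type*} [Field F] [Field K] [Algebra F K]
    [FiniteDimensional F K] [Algebra.IsSeparable F K] (x : K) (g : F[X]) :
    Algebra.norm F (aeval x g)
      = resultant (minpoly F x) g ^ (Module.finrank F K / (minpoly F x).natDegree) := by
  have hx := Algebra.IsSeparable.isIntegral F x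
  have : Algebra.IsSeparable F F⟮x⟯ := Algebra.isSeparable_tower_bot_of_isSeparable F F⟮x⟯ K
  have hfr : Module.finrank F⟮x⟯ K = Module.finrank F K / (minpoly F x).natDegree := by
    rw [← adjoin.finrank hx, ← Module.finrank_mul_finrank F F⟮x⟯ K,
      Nat.mul_div_cancel_left _ Module.finrank_pos]
  have h1 := norm_aeval_gen_eq_resultant (adjoin.powerBasis hx) g
  rw [adjoin.powerBasis_gen, minpoly_gen] at h1
  have h2 : aeval x g = algebraMap F⟮x⟯ K (aeval (AdjoinSimple.gen F x) g) := by
    rw [← aeval_algebraMap_apply, AdjoinSimple.algebraMap_gen]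
  rw [h2, ← Algebra.norm_norm (S := F⟮x⟯), Algebra.norm_algebraMap, map_pow, h1, hfr]

theorem sum_norm_aeval_eq_mangoldtSum {F K : Type*} [Field F] [Finite F] [Field K] [Fintype K]
    [Algebra F K] (χ : MulChar F ℂ) (g : F[X]) :
    ∑ x : K, χ (Algebra.norm F (aeval x g))
      = mangoldtSum (fun f => χ (resultant f g)) (Module.finrank F K) := by
  classical
  have hint : ∀ x : K, IsIntegral F x := fun x => Algebra.IsIntegral.isIntegral x
  have hr : 0 < Module.finrank F K := Module.finrank_pos
  have hdeg : ∀ x : K, (minpoly F x).natDegree ∣ Module.finrank F K := fun x => by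
    rw [← adjoin.finrank (hint x)]
    exact ⟨_, (Module.finrank_mul_finrank F F⟮x⟯ K).symm⟩
  unfold mangoldtSum
  rw [← Finset.sum_fiberwise_of_maps_to (s := Finset.univ)
    (g := fun x : K => (minpoly F x).natDegree)
    (fun x _ => Nat.mem_divisors.mpr ⟨hdeg x, hr.ne'⟩)]
  refine Finset.sum_congr rfl fun d hd => ?_
  have hmaps : ∀ x ∈ Finset.univ.filter (fun x : K => (minpoly F x).natDegree = d),
      minpoly F x ∈ primesOfDegree F d := fun x hx => by
    rw [mem_primesOfDegree]
    exact ⟨⟨minpoly.monic (hint x), (Finset.mem_filter.mp hx).2⟩, minpoly.irreducible (hint x)⟩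
  rw [← Finset.sum_fiberwise_of_maps_to hmaps]
  refine Finset.sum_congr rfl fun P hP => ?_
  rw [mem_primesOfDegree] at hP
  have hsplit : (P.map (algebraMap F K)).Splits := by
    have h1 := (hP.2.natDegree_dvd_iff_dvd_X_pow_card_pow_sub_X (n := Module.finrank F K)).mp
      (hP.1.2 ▸ Nat.dvd_of_mem_divisors hd)
    have h2 := (FiniteField.isSplittingField_sub K F).splits
    rw [← Module.natCard_eq_pow_finrank (K := F) (V := K), Nat.card_eq_fintype_card] at h1
    refine h2.of_dvd ?_ (Polynomial.map_dvd _ h1)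
    exact (Polynomial.map_ne_zero_iff (algebraMap F K).injective).mpr
      (FiniteField.X_pow_card_sub_X_ne_zero F Fintype.one_lt_card)
  have hcard := card_rootSet_eq_natDegree (K := K) (PerfectField.separable_of_irreducible hP.2) hsplit
  have hfib : ((Finset.univ.filter fun x : K => (minpoly F x).natDegree = d).filter
      fun x => minpoly F x = P) = (P.rootSet K).toFinset := by
    ext x
    rw [Finset.mem_filter, Finset.mem_filter, Set.mem_toFinset, mem_rootSet]
    constructor
    · rintro ⟨-, rfl⟩
      exact ⟨hP.2.ne_zero, minpoly.aeval F x⟩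
    · rintro ⟨-, h⟩
      have := minpoly.eq_of_irreducible_of_monic hP.2 h hP.1.1
      exact ⟨⟨Finset.mem_univ _, this ▸ hP.1.2⟩, this.symm⟩
  rw [Finset.sum_congr rfl (g := fun _ => χ (resultant P g) ^ (Module.finrank F K / d)) ?_,
    Finset.sum_const, hfib, Set.toFinset_card, hcard.trans hP.1.2, nsmul_eq_mul]
  intro x hx
  rw [Finset.mem_filter] at hx
  rw [norm_aeval_eq_resultant_pow, map_pow, hx.2]
  exact congrArg (fun e => _ ^ (_ / e)) hP.1.2

end ExtensionSums

section PowerSums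

theorem norm_le_of_norm_sum_pow_le {ι : Type*} [Fintype ι] (α : ι → ℂ) {B C : ℝ} (hB : 0 < B)
    {T : ℕ} (h : ∀ t ≥ T, ‖∑ i, α i ^ t‖ ≤ C * B ^ t) (i : ι) : ‖α i‖ ≤ B := by
  classical
  by_contra! hlt
  set γ := α i
  let e : Polynomial ℂ := ∏ v ∈ (Finset.univ.image α).erase γ, (Polynomial.X - Polynomial.C v)
  have heval : ∀ j, α j ≠ γ → e.eval (α j) = 0 := by
    intro j hj
    rw [Polynomial.eval_prod]
    exact Finset.prod_eq_zero (i := α j)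
      (Finset.mem_erase.mpr ⟨hj, Finset.mem_image_of_mem _ (Finset.mem_univ j)⟩) (by simp)
  have heγ : e.eval γ ≠ 0 := by
    rw [Polynomial.eval_prod, Finset.prod_ne_zero_iff]
    intro v hv
    simpa [sub_eq_zero] using (Finset.ne_of_mem_erase hv).symm
  set M := (Finset.univ.filter fun j => α j = γ).card with hM
  have hMpos : 0 < M := Finset.card_pos.mpr ⟨i, by simp [γ]⟩
  have hkey : ∀ t, ∑ n ∈ Finset.range (e.natDegree + 1), e.coeff n * ∑ j, α j ^ (t + n)
      = M * (γ ^ t * e.eval γ) := by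
    intro t
    calc _ = ∑ j, α j ^ t * e.eval (α j) := by
          simp only [Finset.mul_sum]
          rw [Finset.sum_comm]
          refine Finset.sum_congr rfl fun j _ => ?_
          rw [Polynomial.eval_eq_sum_range, Finset.mul_sum]
          refine Finset.sum_congr rfl fun n _ => ?_
          ring
      _ = ∑ j, if α j = γ then γ ^ t * e.eval γ else 0 := by
          refine Finset.sum_congr rfl fun j _ => ?_
          split_ifs with hj
          · rw [hj]
          · rw [heval j hj, mul_zero]
      _ = _ := by rw [← Finset.sum_filter, Finset.sum_const, nsmul_eq_mul]
  set D := ∑ n ∈ Finset.range (e.natDegree + 1), ‖e.coeff n‖ * (C * B ^ n) with hD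
  have hbound : ∀ t ≥ T, M * ‖e.eval γ‖ * ‖γ‖ ^ t ≤ D * B ^ t := by
    intro t ht
    calc M * ‖e.eval γ‖ * ‖γ‖ ^ t = ‖(M : ℂ) * (γ ^ t * e.eval γ)‖ := by
          rw [norm_mul, norm_mul, norm_pow, Complex.norm_natCast]; ring
      _ ≤ ∑ n ∈ Finset.range (e.natDegree + 1), ‖e.coeff n‖ * (C * B ^ (t + n)) := by
          rw [← hkey]
          refine norm_sum_le_of_le _ fun n _ => ?_
          rw [norm_mul]
          exact mul_le_mul_of_nonneg_left (h _ (by omega)) (norm_nonneg _)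
      _ = D * B ^ t := by
          rw [hD, Finset.sum_mul]
          refine Finset.sum_congr rfl fun n _ => ?_
          ring
  have hε : 0 < M * ‖e.eval γ‖ := by positivity
  have hratio : 1 < ‖γ‖ / B := (one_lt_div hB).mpr hlt
  obtain ⟨n, hn⟩ := pow_unbounded_of_one_lt (D / (M * ‖e.eval γ‖)) hratio
  have h1 := hn.trans_le (pow_le_pow_right₀ hratio.le (le_max_left n T))
  rw [div_pow, div_lt_div_iff₀ hε (by positivity)] at h1
  have h2 := hbound _ (le_max_right n T)
  linarith

/-- A sequence of coefficients satisfying a Newton-type recursion of finite length comes from the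
power sums of finitely many complex numbers. -/
theorem exists_multiset_of_newton {c S : ℕ → ℂ} {N : ℕ} (h0 : c 0 = 1) (hN : ∀ n, N < n → c n = 0)
    (hrec : ∀ n : ℕ, (n : ℂ) * c n = ∑ r ∈ Finset.Icc 1 n, S r * c (n - r)) :
    ∃ s : Multiset ℂ, s.card = N ∧ ∀ r, 1 ≤ r → S r = -∑ i : s, (i : ℂ) ^ r := by
  classical
  let L : Polynomial ℂ := ∑ n ∈ Finset.range (N + 1), Polynomial.monomial (N - n) (c n)
  have hcoeff : ∀ n ≤ N, L.coeff (N - n) = c n := by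
    intro n hn
    rw [Polynomial.finsetSum_coeff, Finset.sum_eq_single n]
    · simp
    · intro j hj hjn
      rw [Finset.mem_range] at hj
      rw [Polynomial.coeff_monomial, if_neg (by omega)]
    · intro h
      exact absurd (Finset.mem_range.mpr (by omega)) h
  have hdeg : L.natDegree = N := by
    refine Polynomial.natDegree_eq_of_le_of_coeff_ne_zero ?_ ?_
    · refine Polynomial.natDegree_sum_le_of_forall_le _ _ fun n _ => ?_
      exact (Polynomial.natDegree_monomial_le _).trans (Nat.sub_le _ _)
    · have := hcoeff 0 (Nat.zero_le _)
      rw [Nat.sub_zero] at this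
      rw [this, h0]
      exact one_ne_zero
  have hlead : L.leadingCoeff = 1 := by
    have := hcoeff 0 (Nat.zero_le _)
    rwa [Nat.sub_zero, h0, ← hdeg] at this
  have hcard : L.roots.card = L.natDegree := (IsAlgClosed.splits L).natDegree_eq_card_roots.symm
  set s := L.roots with hs
  have hsN : s.card = N := by rw [hcard, hdeg]
  have hesymm : ∀ n, c n = (-1) ^ n * s.esymm n := by
    intro n
    rcases le_or_gt n N with hn | hn
    · rw [← hcoeff n hn, Polynomial.coeff_eq_esymm_roots_of_card hcard (by omega), hlead, one_mul,
        hdeg, Nat.sub_sub_self hn]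
    · rw [hN n hn, Multiset.esymm, Multiset.powersetCard_eq_empty _ (by omega)]
      simp
  have hnewton : ∀ n : ℕ, (n : ℂ) * c n
      = -∑ r ∈ Finset.Icc 1 n, (∑ i : s, (i : ℂ) ^ r) * c (n - r) := by
    intro n
    have h1 := congrArg (MvPolynomial.aeval fun i : s => (i : ℂ))
      (MvPolynomial.mul_esymm_eq_sum s ℂ n)
    simp only [map_mul, map_natCast, map_pow, map_neg, map_one, map_sum,
      MvPolynomial.aeval_esymm_eq_multiset_esymm, Multiset.map_univ_coe, MvPolynomial.psum,
      MvPolynomial.aeval_X] at h1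
    have h2 : ∑ a ∈ Finset.HasAntidiagonal.antidiagonal n with a.1 < n,
        (-1) ^ a.1 * s.esymm a.1 * ∑ i : s, (i : ℂ) ^ a.2
          = ∑ r ∈ Finset.Icc 1 n, (∑ i : s, (i : ℂ) ^ r) * c (n - r) := by
      refine Finset.sum_nbij' (fun a => a.2) (fun r => (n - r, r)) ?_ ?_ ?_ ?_ ?_
      · intro a ha
        simp only [Finset.mem_filter, Finset.HasAntidiagonal.mem_antidiagonal, Finset.mem_Icc] at ha ⊢
        omega
      · intro r hr
        simp only [Finset.mem_filter, Finset.HasAntidiagonal.mem_antidiagonal, Finset.mem_Icc] at hr ⊢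
        omega
      · rintro ⟨a, b⟩ ha
        simp only [Finset.mem_filter, Finset.HasAntidiagonal.mem_antidiagonal] at ha
        rw [Prod.mk.injEq]
        exact ⟨by omega, rfl⟩
      · intro r _
        rfl
      · rintro ⟨a, b⟩ ha
        simp only [Finset.mem_filter, Finset.HasAntidiagonal.mem_antidiagonal] at ha
        rw [← hesymm, show n - b = a by omega, mul_comm]
    rw [h2] at h1
    have h3 : ((-1 : ℂ) ^ n) * (-1) ^ n = 1 := by rw [← mul_pow]; simp
    rw [hesymm n]
    linear_combination (-1) ^ n * h1 -
      (∑ r ∈ Finset.Icc 1 n, (∑ i : s, (i : ℂ) ^ r) * c (n - r)) * h3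
  refine ⟨s, hsN, fun r => ?_⟩
  induction r using Nat.strong_induction_on with
  | _ r ih =>
    intro hr
    have h1 := (hrec r).symm.trans (hnewton r)
    obtain ⟨r, rfl⟩ := Nat.exists_eq_add_of_le' hr
    rw [Finset.sum_Icc_succ_top (by omega), Finset.sum_Icc_succ_top (by omega), Nat.sub_self, h0,
      Finset.sum_congr rfl (g := fun j => -((∑ i : s, (i : ℂ) ^ j) * c (r + 1 - j))),
      Finset.sum_neg_distrib] at h1
    · linear_combination h1
    · intro j hj
      rw [Finset.mem_Icc] at hj
      rw [ih j (by omega) hj.1]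
      ring

theorem norm_le_of_newton {c S : ℕ → ℂ} {N : ℕ} (h0 : c 0 = 1) (hN : ∀ n, N < n → c n = 0)
    (hrec : ∀ n : ℕ, (n : ℂ) * c n = ∑ r ∈ Finset.Icc 1 n, S r * c (n - r)) {B C : ℝ} (hB : 0 < B)
    {T : ℕ} (hS : ∀ t ≥ T, ‖S (2 * t)‖ ≤ C * B ^ t) : ‖S 1‖ ≤ N * Real.sqrt B := by
  obtain ⟨s, hs, hsum⟩ := exists_multiset_of_newton h0 hN hrec
  have hroot : ∀ i : s, ‖(i : ℂ)‖ ≤ Real.sqrt B := by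
    intro i
    have := norm_le_of_norm_sum_pow_le (fun i : s => (i : ℂ) ^ 2) hB (T := max T 1) (C := C) ?_ i
    · rw [norm_pow] at this
      exact Real.le_sqrt_of_sq_le this
    · intro t ht
      have h1 := hS t (by omega)
      rw [hsum _ (by omega), norm_neg] at h1
      simpa only [← pow_mul] using h1
  rw [hsum 1 le_rfl, norm_neg]
  calc ‖∑ i : s, (i : ℂ) ^ 1‖ ≤ ∑ _i : s, Real.sqrt B :=
        norm_sum_le_of_le _ fun i _ => by simpa using hroot i
    _ = N * Real.sqrt B := by
        rw [Finset.sum_const, nsmul_eq_mul, Finset.card_univ, Multiset.card_coe, hs]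

end PowerSums

section WeilBound

open Polynomial

variable {F : Type*} [Field F] [Fintype F]

theorem norm_charSum_le {k m : ℕ} {g u : F[X]} (hg : g.Monic) (hgk : g.natDegree = k)
    (hk : 1 ≤ k) (hcop : k.Coprime m) (hm : m ∣ Fintype.card F - 1) {χ : MulChar F ℂ}
    (hχm : χ ^ m = 1) (hu0 : resultant g u ≠ 0) (hu1 : χ (resultant g u) ≠ 1) :
    ‖∑ x : F, χ (g.eval x)‖ ≤ ((k : ℝ) - 1) * Real.sqrt (Fintype.card F) := by
  have hχ : χ ≠ 1 := by
    rintro rfl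
    exact hu1 (MulChar.one_apply hu0.isUnit)
  obtain ⟨p, hp⟩ := CharP.exists F
  obtain ⟨-, hpp, -⟩ := FiniteField.card F p
  have : Fact p.Prime := ⟨hpp⟩
  have hq1 := Fintype.one_lt_card (α := F)
  set ψ : F[X] → ℂ := fun f => χ (resultant f g) with hψ
  have hψ1 : ψ 1 = 1 := by simp [hψ]
  have key := norm_le_of_newton (c := monicSum ψ) (S := mangoldtSum ψ) (N := k - 1)
    (B := Fintype.card F) (C := 2 * m * (3 * k + 3) + k) (T := m * (2 * k + 2) + 1)
    (by rw [monicSum_zero, hψ1])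
    (fun n hn => monicSum_resultant_eq_zero χ hg hu0 hu1 (by omega))
    (natCast_mul_monicSum ψ hψ1 fun f f' hf hf' => apply_resultant_mul χ g hf hf')
    (by positivity) ?_
  · have h1 := sum_norm_aeval_eq_mangoldtSum (K := F) χ g
    rw [Module.finrank_self] at h1
    rw [← h1, Nat.cast_sub hk, Nat.cast_one] at key
    simpa [Algebra.norm_self] using key
  · intro t ht
    have : NeZero (2 * t) := ⟨by omega⟩
    have := Fintype.ofFinite (FiniteField.Extension F p (2 * t))
    have h1 := sum_norm_aeval_eq_mangoldtSum (K := FiniteField.Extension F p (2 * t)) χ g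
    rw [FiniteField.finrank_extension] at h1
    rw [← h1]
    refine norm_charSum_extension_le g hg hgk hcop hm ?_ ?_ χ hχ hχm
    · rw [← Nat.card_eq_fintype_card, FiniteField.natCard_extension, Nat.card_eq_fintype_card,
        ← pow_mul, mul_comm]
    · exact (Nat.lt_of_succ_le ht).trans (Nat.lt_pow_self hq1)

omit [Fintype F] in
theorem resultant_X_mul_one_add (a : F) {h : F[X]} (hh : h.Monic) (h0 : h.coeff 0 = 1) :
    resultant (X * h) (1 + C (a - 1) * h) = a := by
  rw [monic_X.natDegree_mul hh, resultant_mul_left _ _ _ _ le_rfl]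
  have h1 : resultant h (1 + C (a - 1) * h) = 1 := by
    have := hh.resultant_mul_add_mul 1 1 (C (a - 1))
    rw [mul_one, mul_comm h] at this
    rw [this]
    rw [resultant_one_right, natDegree_one, pow_zero, mul_one]
  have h2 := resultant_X_pow_left (1 + C (a - 1) * h) 1 (1 + C (a - 1) * h).natDegree le_rfl
  rw [pow_one, pow_one] at h2
  rw [h1, natDegree_X, h2]
  simp [h0]

omit [Fintype F] in
theorem natDegree_geom_sum_X {k : ℕ} (hk : 1 ≤ k) :
    (X * ∑ i ∈ Finset.range k, X ^ i : F[X]).natDegree = k := by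
  have hh : (∑ i ∈ Finset.range k, X ^ i : F[X]).Monic := monic_geom_sum_X (by omega)
  have h1 := congrArg natDegree (geom_sum_mul (X : F[X]) k)
  rw [← C_1, natDegree_X_pow_sub_C, hh.natDegree_mul (monic_X_sub_C 1), natDegree_X_sub_C] at h1
  rw [monic_X.natDegree_mul hh, natDegree_X, add_comm, h1]

theorem norm_charSum_geom_sum_le {k m : ℕ} (hk : 1 ≤ k) (hcop : k.Coprime m)
    (hm : m ∣ Fintype.card F - 1) {χ : MulChar F ℂ} (hχ : χ ≠ 1) (hχm : χ ^ m = 1) :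
    ‖∑ x : F, χ (x * ∑ i ∈ Finset.range k, x ^ i)‖
      ≤ ((k : ℝ) - 1) * Real.sqrt (Fintype.card F) := by
  obtain ⟨a, ha⟩ := MulChar.ne_one_iff.mp hχ
  have hh : (∑ i ∈ Finset.range k, X ^ i : F[X]).Monic := monic_geom_sum_X (by omega)
  have h0 : (∑ i ∈ Finset.range k, X ^ i : F[X]).coeff 0 = 1 := by
    obtain ⟨k, rfl⟩ := Nat.exists_eq_add_of_le' hk
    simp [Finset.sum_range_succ', coeff_zero_eq_eval_zero, eval_finsetSum]
  have hres := resultant_X_mul_one_add (a : F) hh h0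
  have := norm_charSum_le (monic_X.mul hh) (natDegree_geom_sum_X hk) hk hcop hm hχm
    (by rw [hres]; exact a.ne_zero) (by rwa [hres])
  simpa [eval_finsetSum] using this

end WeilBound

section Counting

variable {F : Type*} [Field F] [Fintype F]

open Polynomial in
theorem card_filter_geom_sum_le [DecidableEq F] {k : ℕ} (hk : 1 ≤ k) :
    (Finset.univ.filter fun x : F => x * ∑ i ∈ Finset.range k, x ^ i = 0).card ≤ k := by
  have hm : (X * ∑ i ∈ Finset.range k, X ^ i : F[X]).Monic :=
    monic_X.mul (monic_geom_sum_X (by omega))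
  refine le_of_le_of_eq ?_ (natDegree_geom_sum_X (F := F) hk)
  refine card_le_degree_of_subset_roots fun x hx => ?_
  rw [mem_roots hm.ne_zero]
  simpa [IsRoot, eval_finsetSum] using hx

theorem exists_eq_pow_of_apply_eq_one {m : ℕ} {χ : MulChar F ℂ}
    (hχ : orderOf χ = m) {v : F} (hv : χ v = 1) : ∃ y, y ^ m = v ∧ y ≠ 0 := by
  have hv0 : v ≠ 0 := by
    rintro rfl
    rw [MulChar.map_zero] at hv
    exact zero_ne_one hv
  obtain ⟨ζ, hζ⟩ := IsCyclic.exists_generator (α := Fˣ)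
  obtain ⟨i, hi⟩ := (Submonoid.mem_powers_iff _ _).mp
    ((mem_powers_iff_mem_zpowers).mpr (hζ (Units.mk0 v hv0)))
  have hvi : (ζ : F) ^ i = v := by simpa using congrArg Units.val hi
  have h1 : χ ^ i = 1 := by
    rw [MulChar.eq_iff hζ]
    rw [MulChar.pow_apply_coe, ← map_pow, hvi, hv, MulChar.one_apply_coe]
  obtain ⟨j, rfl⟩ : m ∣ i := hχ ▸ orderOf_dvd_of_pow_eq_one h1
  exact ⟨(ζ : F) ^ j, by rw [← pow_mul, mul_comm, hvi], pow_ne_zero _ ζ.ne_zero⟩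

theorem re_sum_pow_apply_le_card [DecidableEq F] {m : ℕ} (hm : m ∣ Fintype.card F - 1)
    {χ : MulChar F ℂ} (hχ : orderOf χ = m) (v : F) :
    (∑ j ∈ Finset.range m, (χ ^ j) v).re ≤ (Finset.univ.filter fun y : F => y ^ m = v).card := by
  by_cases hv0 : v = 0
  · subst hv0
    simp [MulChar.map_zero]
  have hpow : ∀ j, (χ ^ j) v = χ v ^ j := by
    intro j
    have := MulChar.pow_apply_coe χ j (Units.mk0 v hv0)
    simpa using this
  simp only [hpow]
  by_cases h : χ v = 1
  · obtain ⟨y, rfl, hy⟩ := exists_eq_pow_of_apply_eq_one hχ h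
    obtain ⟨d, hd⟩ := hm
    rw [card_filter_pow_eq_pow hd hy, h]
    simp
  · have h2 : χ v ^ m = 1 := by rw [← hpow, ← hχ, pow_orderOf_eq_one, MulChar.one_apply (Ne.isUnit hv0)]
    have : ∑ j ∈ Finset.range m, χ v ^ j = 0 := by
      rw [geom_sum_eq h, h2, sub_self, zero_div]
    rw [this]
    simp

end Counting

theorem kummer_curve_point_count_lower_bound
    {F : Type*} [Field F] [Fintype F] (q k : ℕ)
    (hq : Fintype.card F = q)
    (b c : F) (hb : b ≠ 0) (hc : c ≠ 0)
    (hk1 : 1 ≤ k) (hk2 : k < q - 1) :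
    (({p : F × F |
        c * p.1 * p.2 ^ (Nat.gcd (k + 1) (q - 1)) * (∑ i ∈ Finset.range k, p.1 ^ i)
          = b}.ncard : ℝ)) ≥
      (q : ℝ) - ((k : ℝ) - 1) * ((Nat.gcd (k + 1) (q - 1) : ℝ) - 1) * Real.sqrt q
        - (k : ℝ) := by
  classical
  set m := Nat.gcd (k + 1) (q - 1) with hm
  have hm0 : 0 < m := Nat.gcd_pos_of_pos_left _ (by omega)
  have hmq : m ∣ Fintype.card F - 1 := hq ▸ Nat.gcd_dvd_right _ _
  have hcop : k.Coprime m :=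
    Nat.Coprime.coprime_dvd_right (Nat.gcd_dvd_left _ _) (by simp)
  obtain ⟨χ, hχ⟩ := MulChar.exists_mulChar_orderOf F hmq
    (Complex.isPrimitiveRoot_exp m hm0.ne')
  let G : F → F := fun x => x * ∑ i ∈ Finset.range k, x ^ i
  have hcount : ({p : F × F | c * p.1 * p.2 ^ m * (∑ i ∈ Finset.range k, p.1 ^ i) = b}.ncard)
      = ∑ x : F, (Finset.univ.filter fun y : F => y ^ m = b / (c * G x) ∧ G x ≠ 0).card := by
    simp only [Finset.card_filter]
    rw [← Fintype.sum_prod_type' (f := fun x y : F => if y ^ m = b / (c * G x) ∧ G x ≠ 0 then 1 else 0),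
      ← Finset.card_filter, ← Set.ncard_coe_finset]
    congr 1
    ext ⟨x, y⟩
    simp only [Set.mem_ofPred_eq, Finset.coe_filter, Finset.mem_univ, true_and]
    have hG : c * x * y ^ m * (∑ i ∈ Finset.range k, x ^ i) = y ^ m * (c * G x) := by
      simp only [G]
      ring
    rw [hG]
    constructor
    · intro h
      have h0 : c * G x ≠ 0 := by
        intro h0
        rw [h0, mul_zero] at h
        exact hb h.symm
      exact ⟨(eq_div_iff h0).mpr h, right_ne_zero_of_mul h0⟩
    · rintro ⟨h, h0⟩
      exact (eq_div_iff (mul_ne_zero hc h0)).mp h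
  have hfib : ∀ x : F, (∑ j ∈ Finset.range m, (χ ^ j) (b / (c * G x))).re
      ≤ (Finset.univ.filter fun y : F => y ^ m = b / (c * G x) ∧ G x ≠ 0).card := by
    intro x
    by_cases hx : G x = 0
    · rw [hx]
      simp [MulChar.map_zero]
    · simpa [hx] using re_sum_pow_apply_le_card hmq hχ (b / (c * G x))
  have hzero : (q : ℝ) - k ≤ (∑ x : F, (χ ^ 0) (b / (c * G x))).re := by
    have hval : ∀ x : F, (χ ^ 0) (b / (c * G x)) = if G x ≠ 0 then 1 else 0 := by
      intro x
      split_ifs with hx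
      · rw [pow_zero, MulChar.one_apply (div_ne_zero hb (mul_ne_zero hc hx)).isUnit]
      · rw [not_not.mp hx, mul_zero, div_zero, MulChar.map_zero]
    have hcard : (Finset.univ.filter fun x : F => G x = 0).card ≤ k := card_filter_geom_sum_le hk1
    have hsum := Finset.card_filter_add_card_filter_not (s := (Finset.univ : Finset F))
      (fun x : F => G x = 0)
    rw [Finset.card_univ, hq] at hsum
    simp only [hval]
    rw [Finset.sum_boole, Complex.natCast_re, ← hsum]
    push_cast
    have : ((Finset.univ.filter fun x : F => G x = 0).card : ℝ) ≤ k := by exact_mod_cast hcard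
    linarith
  have hpos : ∀ j ∈ Finset.range (m - 1),
      -(((k : ℝ) - 1) * Real.sqrt q) ≤ (∑ x : F, (χ ^ (j + 1)) (b / (c * G x))).re := by
    intro j hj
    rw [Finset.mem_range] at hj
    have hne : (χ ^ (j + 1))⁻¹ ≠ 1 := by
      rw [inv_ne_one]
      exact pow_ne_one_of_lt_orderOf (by omega) (by omega)
    have hpm : ((χ ^ (j + 1))⁻¹) ^ m = 1 := by
      rw [inv_pow, ← pow_mul, mul_comm, pow_mul, ← hχ, pow_orderOf_eq_one, one_pow, inv_one]
    have hW := norm_charSum_geom_sum_le hk1 hcop hmq hne hpm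
    have heq : ∑ x : F, (χ ^ (j + 1)) (b / (c * G x))
        = (χ ^ (j + 1)) (b / c) * ∑ x : F, (χ ^ (j + 1))⁻¹ (G x) := by
      rw [Finset.mul_sum]
      refine Finset.sum_congr rfl fun x _ => ?_
      rw [MulChar.inv_apply', ← map_mul, div_mul_eq_div_div, div_eq_mul_inv (b / c)]
    have hnorm : ‖(χ ^ (j + 1)) (b / c)‖ = 1 := by
      refine Complex.norm_eq_one_of_pow_eq_one (n := m) ?_ hm0.ne'
      rw [← MulChar.pow_apply' _ hm0.ne', ← pow_mul, mul_comm, pow_mul, ← hχ, pow_orderOf_eq_one,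
        one_pow, MulChar.one_apply (div_ne_zero hb hc).isUnit]
    rw [hq] at hW
    have h1 : ‖∑ x : F, (χ ^ (j + 1)) (b / (c * G x))‖ ≤ ((k : ℝ) - 1) * Real.sqrt q := by
      rw [heq, norm_mul, hnorm, one_mul]
      exact hW
    exact neg_le_of_abs_le ((Complex.abs_re_le_norm _).trans h1)
  rw [hcount, Nat.cast_sum, ge_iff_le]
  refine le_trans ?_ (Finset.sum_le_sum fun x _ => hfib x)
  rw [← Complex.re_sum, Finset.sum_comm]
  obtain ⟨n, hn⟩ := Nat.exists_eq_add_of_le' hm0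
  have hsum := Finset.sum_le_sum hpos
  rw [Finset.sum_const, Finset.card_range, nsmul_eq_mul, hn, Nat.add_sub_cancel] at hsum
  rw [hn, Finset.sum_range_succ', Complex.add_re, Complex.re_sum]
  push_cast
  linarith
end

section
/- There exists a primitive element ζ of F_9 (i.e., a generator of the cyclic group F_9*) such that, setting a = ζ^5, b = ζ^6, c = ζ^3, the map f : F_9 → F_9 defined by f(x) = (((x + a)^7 + b)^7 + c)^7 is a bijection of F_9, and the map x ↦ f(x) + x² is also a bijection of F_9. -/
/-- The concrete model `𝔽₃[ω]` with `ω² = 1 + ω` of the field with nine elements. -/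
abbrev F9Model : Type := QuadraticAlgebra (ZMod 3) 1 1

theorem F9Model.surjective_mk {p : F9Model → F9Model}
    (h : ∀ y₁ y₂ : ZMod 3, ∃ x₁ x₂ : ZMod 3, p ⟨x₁, x₂⟩ = ⟨y₁, y₂⟩) :
    Function.Surjective p := fun ⟨y₁, y₂⟩ =>
  let ⟨_, _, hx⟩ := h y₁ y₂
  ⟨_, hx⟩

/-- The polynomial map `(((x + z⁵)⁷ + z⁶)⁷ + z³)⁷`, of Carlitz rank three over the field with nine
elements. -/
abbrev carlitzMap {R : Type*} [CommRing R] (z x : R) : R :=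
  (((x + z ^ 5) ^ 7 + z ^ 6) ^ 7 + z ^ 3) ^ 7

theorem F9Model.surjective_carlitzMap :
    Function.Surjective (carlitzMap (⟨0, 1⟩ : F9Model)) :=
  surjective_mk (by decide +kernel)

theorem F9Model.surjective_carlitzMap_add_sq :
    Function.Surjective (fun x => carlitzMap (⟨0, 1⟩ : F9Model) x + x ^ 2) :=
  surjective_mk (by decide +kernel)

section

variable {F : Type*} [Field F] [Fintype F]

theorem three_eq_zero_of_card_eq_nine (hF : Fintype.card F = 9) : (3 : F) = 0 := by
  have h : ((Fintype.card F : ℕ) : F) = 0 := Nat.cast_card_eq_zero F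
  rw [hF] at h
  push_cast at h
  exact pow_eq_zero_iff two_ne_zero |>.mp (by linear_combination h : (3 : F) ^ 2 = 0)

/-- A field with nine elements is a homomorphic image of `F9Model`. -/
theorem exists_surjective_ringHom_F9Model (hF : Fintype.card F = 9) :
    ∃ φ : F9Model →+* F, Function.Surjective φ := by
  have h3 := three_eq_zero_of_card_eq_nine hF
  have : CharP F 3 := (CharP.charP_iff_prime_eq_zero Nat.prime_three).2 (by exact_mod_cast h3)
  let : Algebra (ZMod 3) F := ZMod.algebra F 3
  obtain ⟨g, hg⟩ := IsCyclic.exists_generator (α := Fˣ)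
  have hord : orderOf g = 8 := by
    rw [orderOf_eq_card_of_forall_mem_zpowers hg, Nat.card_units, Nat.card_eq_fintype_card, hF]
  have hg8 : (g : F) ^ 8 = 1 := by
    have := pow_orderOf_eq_one g
    rw [hord] at this
    rw [← Units.val_pow_eq_pow_val, this, Units.val_one]
  have hg4 : (g : F) ^ 4 ≠ 1 := by
    intro h
    have := orderOf_dvd_of_pow_eq_one (x := g) (n := 4)
      (Units.ext (by rw [Units.val_pow_eq_pow_val, h, Units.val_one]))
    rw [hord] at this
    omega
  have hprod : ((g : F) ^ 2 - g - 1) * ((-(g : F)) ^ 2 - -g - 1) = 0 := by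
    have h : ((g : F) ^ 4 - 1) * (g ^ 4 + 1) = 0 := by linear_combination hg8
    have h' := (mul_eq_zero.mp h).resolve_left (sub_ne_zero.mpr hg4)
    linear_combination h' - g ^ 2 * h3
  obtain ⟨φ, u, hu⟩ : ∃ (φ : F9Model →+* F) (u : F9Model), φ u = g := by
    rcases mul_eq_zero.mp hprod with h | h
    · exact ⟨(QuadraticAlgebra.lift ⟨(g : F), by
        rw [one_smul, one_smul]; linear_combination h⟩ : F9Model →ₐ[ZMod 3] F), ⟨0, 1⟩,
        by simp [QuadraticAlgebra.lift]⟩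
    · exact ⟨(QuadraticAlgebra.lift ⟨-(g : F), by
        rw [one_smul, one_smul]; linear_combination h⟩ : F9Model →ₐ[ZMod 3] F), -⟨0, 1⟩,
        by simp [QuadraticAlgebra.lift]⟩
  refine ⟨φ, fun y => ?_⟩
  rcases eq_or_ne y 0 with rfl | hy
  · exact ⟨0, map_zero φ⟩
  · obtain ⟨n, hn⟩ := mem_powers_iff_mem_zpowers.mpr (hg (Units.mk0 y hy))
    refine ⟨u ^ n, ?_⟩
    rw [map_pow, hu, ← Units.val_pow_eq_pow_val]
    exact congrArg Units.val hn

end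

theorem example_carlitz_rank_three_F9
    {F : Type*} [Field F] [Fintype F] (hF : Fintype.card F = 9) :
    ∃ ζ : F, orderOf ζ = 8 ∧
      Function.Bijective (fun x : F => (((x + ζ ^ 5) ^ 7 + ζ ^ 6) ^ 7 + ζ ^ 3) ^ 7) ∧
      Function.Bijective
        (fun x : F => (((x + ζ ^ 5) ^ 7 + ζ ^ 6) ^ 7 + ζ ^ 3) ^ 7 + x ^ 2) := by
  obtain ⟨φ, hφ⟩ := exists_surjective_ringHom_F9Model hF
  have h3 := three_eq_zero_of_card_eq_nine hF
  have h4 : φ ⟨0, 1⟩ ^ 4 = -1 := by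
    rw [← map_pow, show (⟨0, 1⟩ : F9Model) ^ 4 = -1 by decide +kernel, map_neg, map_one]
  refine ⟨φ ⟨0, 1⟩, ?_, ?_, ?_⟩
  · refine orderOf_eq_prime_pow (p := 2) (n := 2) (fun h => ?_) ?_
    · exact one_ne_zero (α := F) (by linear_combination h3 - h4 + h)
    · linear_combination (φ ⟨0, 1⟩ ^ 4 - 1) * h4
  · refine Finite.surjective_iff_bijective.mp fun y => ?_
    obtain ⟨v, rfl⟩ := hφ y
    obtain ⟨x, rfl⟩ := F9Model.surjective_carlitzMap v
    exact ⟨φ x, by simp only [map_add, map_pow]⟩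
  · refine Finite.surjective_iff_bijective.mp fun y => ?_
    obtain ⟨v, rfl⟩ := hφ y
    obtain ⟨x, rfl⟩ := F9Model.surjective_carlitzMap_add_sq v
    exact ⟨φ x, by simp only [map_add, map_pow]⟩
end
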